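/- There exists a constant c > 0 such that for every irrational θ ∈ [0,1] and every natural number N ≥ 2 there exist a complex Hilbert space H, unitary operators U, V on H with U·V = e^{2πiθ}·V·U, a unit vector e₀ ∈ H with ⟨U^{a}V^{b}·e₀, e₀⟩ = 0 for all (a,b) ∈ ℤ² ∖ {(0,0)}, and a finitely supported family of complex coefficients (a_k)_{k ∈ ℤ²} defining the non-commutative trigonometric polynomial f := Σ_k a_k·U^{k₁}V^{k₂}, such that, with τ(T) := ⟨T·e₀, e₀⟩: τ(|δ₁²f|) + τ(|δ₂²f|) ≤ 1 and τ(|δ₁δ₂f|) ≥ c·(log N)^{1/2}. -/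

import Mathlib

open scoped Real
open Complex

noncomputable section

/-- A bundled complex Hilbert space. -/
structure HilbertSetup where
  H : Type
  [normed : NormedAddCommGroup H]
  [ips : InnerProductSpace ℂ H]
  [complete : CompleteSpace H]

attribute [instance] HilbertSetup.normed HilbertSetup.ips HilbertSetup.complete

variable {H : Type*} [NormedAddCommGroup H] [InnerProductSpace ℂ H] [CompleteSpace H]

/-- The monomial `U^{k₁} V^{k₂}`. -/
def qMono (U V : unitary (H →L[ℂ] H)) (k : ℤ × ℤ) : H →L[ℂ] H :=
  ((U ^ k.1 * V ^ k.2 : unitary (H →L[ℂ] H)) : H →L[ℂ] H)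

/-- The vector state `τ(T) = ⟨T e₀, e₀⟩` (in Mathlib's convention `⟪e₀, T e₀⟫`). -/
def vecState (e₀ : H) (T : H →L[ℂ] H) : ℂ :=
  @inner ℂ H _ e₀ (T e₀)

/-- The absolute value `|T| = (T^* T)^{1/2}` of a bounded operator. -/
def opAbs (T : H →L[ℂ] H) : H →L[ℂ] H :=
  CFC.sqrt (star T * T)

/-- The non-commutative `L¹` quantity `τ(|T|)`, a real number since `|T| ≥ 0`. -/
def l1Norm (e₀ : H) (T : H →L[ℂ] H) : ℝ :=
  (vecState e₀ (opAbs T)).re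

/-- The factor `p_j = I + (1/2)(U^{(−1)^{j−1} m_j} V^{m_j} + V^{−m_j} U^{−(−1)^{j−1} m_j})`. -/
def rieszFactor (U V : unitary (H →L[ℂ] H)) (m : ℕ → ℕ) (j : ℕ) : H →L[ℂ] H :=
  1 + (2⁻¹ : ℂ) •
    (((U ^ ((-1 : ℤ) ^ (j - 1) * (m j : ℤ)) * V ^ (m j : ℤ) :
        unitary (H →L[ℂ] H)) : H →L[ℂ] H)
      + ((V ^ (-(m j : ℤ)) * U ^ (-((-1 : ℤ) ^ (j - 1) * (m j : ℤ))) :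
        unitary (H →L[ℂ] H)) : H →L[ℂ] H))

/-- The non-commutative Riesz product `P_N = p_N ⋯ p_1` (with `P_0 = I`). -/
def rieszProd (U V : unitary (H →L[ℂ] H)) (m : ℕ → ℕ) : ℕ → H →L[ℂ] H
  | 0 => 1
  | N + 1 => rieszFactor U V m (N + 1) * rieszProd U V m N

/-- The Fourier coefficient `T̂(k) = τ((U^{k₁}V^{k₂})^* T)`. -/
def qFourier (e₀ : H) (U V : unitary (H →L[ℂ] H)) (T : H →L[ℂ] H) (k : ℤ × ℤ) : ℂ :=
  vecState e₀ (star (qMono U V k) * T)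

/-- The base lattice vector `((−1)^{l−1} m_l, m_l) ∈ ℤ²`. -/
def baseVec (m : ℕ → ℕ) (l : ℕ) : ℤ × ℤ :=
  ((-1 : ℤ) ^ (l - 1) * (m l : ℤ), (m l : ℤ))

/-- The combinatorial set
`M_j = { ((−1)^{j−1}m_j, m_j) + Σ_{l=1}^{j−1} ξ_l ((−1)^{l−1}m_l, m_l) : ξ_l ∈ {−1,0,1} }`. -/
def Mset (m : ℕ → ℕ) (j : ℕ) : Finset (ℤ × ℤ) :=
  Finset.image
    (fun ξ : Fin (j - 1) → Fin 3 =>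
      baseVec m j + ∑ l : Fin (j - 1), (((ξ l : ℕ) : ℤ) - 1) • baseVec m ((l : ℕ) + 1))
    Finset.univ

/-- The `i`-th coordinate of `k ∈ ℤ²` (`i = 1` gives `k₁`, `i = 2` gives `k₂`). -/
def kCoord (i : ℕ) (k : ℤ × ℤ) : ℤ := if i = 1 then k.1 else k.2

/-- `δ_a δ_b (W_N)`: the coefficientwise derivative of the modified Riesz product
`W_N = −(1/4π²) Σ_{j=1}^{N} Σ_{k ∈ M_j} k₂^{−2} (P̂_N(k) U^{k₁}V^{k₂} + P̂_N(−k) U^{−k₁}V^{−k₂})`,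
the coefficient of `U^{k₁}V^{k₂}` being multiplied by `(2πi k_a)(2πi k_b)`. -/
def derivW (e₀ : H) (U V : unitary (H →L[ℂ] H)) (m : ℕ → ℕ) (N : ℕ) (a b : ℕ) : H →L[ℂ] H :=
  (-(1 / (4 * (π : ℂ) ^ 2))) •
    ∑ j ∈ Finset.Icc 1 N, ∑ k ∈ Mset m j,
      ((((k.2 : ℂ) ^ 2)⁻¹ *
          ((2 * (π : ℂ) * Complex.I * (kCoord a k : ℂ)) *
            (2 * (π : ℂ) * Complex.I * (kCoord b k : ℂ))) *
          qFourier e₀ U V (rieszProd U V m N) k) • qMono U V k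
        + (((k.2 : ℂ) ^ 2)⁻¹ *
          ((2 * (π : ℂ) * Complex.I * (kCoord a (-k) : ℂ)) *
            (2 * (π : ℂ) * Complex.I * (kCoord b (-k) : ℂ))) *
          qFourier e₀ U V (rieszProd U V m N) (-k)) • qMono U V (-k))

end

noncomputable section

/-- The non-commutative trigonometric polynomial `f = Σ_k a_k U^{k₁} V^{k₂}` with finitely
supported coefficients `a`. -/
def trigPoly {H : Type*} [NormedAddCommGroup H] [InnerProductSpace ℂ H] [CompleteSpace H]
    (U V : unitary (H →L[ℂ] H)) (a : (ℤ × ℤ) →₀ ℂ) : H →L[ℂ] H :=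
  ∑ k ∈ a.support, a k • qMono U V k

/-- `δ_i δ_j f` for `f = Σ_k a_k U^{k₁} V^{k₂}`: the coefficient of `U^{k₁}V^{k₂}` is
multiplied by `(2πi k_i)(2πi k_j)`. -/
def derivPoly {H : Type*} [NormedAddCommGroup H] [InnerProductSpace ℂ H] [CompleteSpace H]
    (U V : unitary (H →L[ℂ] H)) (a : (ℤ × ℤ) →₀ ℂ) (i j : ℕ) : H →L[ℂ] H :=
  ∑ k ∈ a.support,
    ((2 * (π : ℂ) * Complex.I * (kCoord i k : ℂ)) *
      (2 * (π : ℂ) * Complex.I * (kCoord j k : ℂ)) * a k) • qMono U V k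

section TraceState

variable {H : Type*} [NormedAddCommGroup H] [InnerProductSpace ℂ H]

/-- The vector state as a continuous linear functional. -/
def vecStateL (e : H) : (H →L[ℂ] H) →L[ℂ] ℂ :=
  (innerSL ℂ e).comp (ContinuousLinearMap.apply ℂ H e)

lemma vecStateL_apply (e : H) (T : H →L[ℂ] H) : vecStateL e T = vecState e T := rfl

lemma norm_vecStateL_le {e : H} (he : ‖e‖ = 1) (T : H →L[ℂ] H) : ‖vecStateL e T‖ ≤ ‖T‖ := by
  have h := norm_inner_le_norm (𝕜 := ℂ) e (T e)
  have h' := T.le_opNorm e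
  rw [he] at h h'
  simp only [one_mul, mul_one] at h h'
  exact h.trans h'

lemma vecStateL_one {e : H} (he : ‖e‖ = 1) : vecStateL e 1 = 1 := by
  change inner ℂ e e = 1
  simp [he]

variable [CompleteSpace H]

/-- The vector state is tracial on the set `S`. -/
def IsTracialOn (e : H) (S : Set (H →L[ℂ] H)) : Prop :=
  ∀ X ∈ S, ∀ Y ∈ S, vecStateL e (X * Y) = vecStateL e (Y * X)

lemma isTracialOn_closure {e : H} {S : Set (H →L[ℂ] H)} (h : IsTracialOn e S) :
    IsTracialOn e (closure S) := by
  have key : ∀ Y ∈ S, ∀ X ∈ closure S, vecStateL e (X * Y) = vecStateL e (Y * X) := by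
    intro Y hY X hX
    have hc : IsClosed {X | vecStateL e (X * Y) = vecStateL e (Y * X)} :=
      isClosed_eq (by fun_prop) (by fun_prop)
    exact closure_minimal (fun X hX => h X hX Y hY) hc hX
  intro X hX Y hY
  have hc : IsClosed {Y | vecStateL e (X * Y) = vecStateL e (Y * X)} :=
    isClosed_eq (by fun_prop) (by fun_prop)
  exact closure_minimal (fun Y hY => key Y hY X hX) hc hY

lemma vecStateL_star_mul_self_re (e : H) (Y : H →L[ℂ] H) :
    (vecStateL e (star Y * Y)).re = ‖Y e‖ ^ 2 := by
  have : vecStateL e (star Y * Y) = inner ℂ (Y e) (Y e) := by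
    change inner ℂ e ((star Y) (Y e)) = _
    rw [ContinuousLinearMap.star_eq_adjoint, ContinuousLinearMap.adjoint_inner_right]
  rw [this, inner_self_eq_norm_sq_to_K]
  norm_cast

lemma norm_vecStateL_star_conj_le (e : H) (X Y : H →L[ℂ] H) :
    ‖vecStateL e (star Y * X * Y)‖ ≤ ‖X‖ * (vecStateL e (star Y * Y)).re := by
  have : vecStateL e (star Y * X * Y) = inner ℂ (Y e) (X (Y e)) := by
    change inner ℂ e ((star Y) (X (Y e))) = _
    rw [ContinuousLinearMap.star_eq_adjoint, ContinuousLinearMap.adjoint_inner_right]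
  rw [this, vecStateL_star_mul_self_re]
  calc _ ≤ ‖Y e‖ * ‖X (Y e)‖ := norm_inner_le_norm _ _
    _ ≤ ‖Y e‖ * (‖X‖ * ‖Y e‖) := by gcongr; exact X.le_opNorm _
    _ = _ := by ring

lemma IsTracialOn.norm_mul_star_mul_self_le {e : H} {S : StarSubalgebra ℂ (H →L[ℂ] H)}
    (h : IsTracialOn e (S : Set (H →L[ℂ] H))) {X Y : H →L[ℂ] H} (hX : X ∈ S) (hY : Y ∈ S) :
    ‖vecStateL e (X * (star Y * Y))‖ ≤ ‖X‖ * (vecStateL e (star Y * Y)).re := by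
  have hY' : star Y ∈ S := star_mem hY
  have h1 : vecStateL e (X * (star Y * Y)) = vecStateL e (star (star Y) * X * star Y) := by
    rw [star_star, ← mul_assoc, h _ (mul_mem hX hY') _ hY, ← mul_assoc]
  have h2 : vecStateL e (star Y * Y) = vecStateL e (star (star Y) * star Y) := by
    rw [star_star, h _ hY' _ hY]
  rw [h1, h2]
  exact norm_vecStateL_star_conj_le e X (star Y)

lemma opAbs_eq_cfc (T : H →L[ℂ] H) : opAbs T = cfc Real.sqrt (star T * T) := by
  rw [opAbs, CFC.sqrt_eq_real_sqrt _ (star_mul_self_nonneg T), cfcₙ_eq_cfc]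

/-- An approximate polar decomposition inside a closed star subalgebra. -/
lemma exists_approx_polar {S : StarSubalgebra ℂ (H →L[ℂ] H)}
    (hS : IsClosed (S : Set (H →L[ℂ] H))) {T : H →L[ℂ] H} (hT : T ∈ S) {s : ℝ} (hs : 0 < s) :
    ∃ V ∈ S, ∃ R ∈ S, ‖V‖ ≤ 1 ∧ star R * R = opAbs T ∧ ‖T - V * opAbs T‖ ≤ s ∧
      ‖opAbs T - star V * T‖ ≤ s := by
  set Q := star T * T with hQdef
  have hQ : 0 ≤ Q := star_mul_self_nonneg T
  have hQsa : IsSelfAdjoint Q := hQ.isSelfAdjoint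
  have hQS : Q ∈ S := mul_mem (star_mem hT) hT
  have hcfc : ∀ f : ℝ → ℝ, cfc f Q ∈ S := fun f => cfc_mem (hs := hS) f hQS
  have hsp : ∀ x ∈ spectrum ℝ Q, 0 ≤ x := fun x hx => spectrum_nonneg_of_nonneg hQ hx
  set g : ℝ → ℝ := fun x => 1 / (√x + s) with hg
  have hpos : ∀ x : ℝ, √x + s ≠ 0 := fun x => by positivity
  have hgc : Continuous g := by
    rw [hg]
    exact continuous_const.div (by fun_prop) hpos
  set G := cfc g Q with hG
  have hGsa : star G = G := (cfc_predicate g Q : IsSelfAdjoint _)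
  have hA : opAbs T = cfc Real.sqrt Q := opAbs_eq_cfc T
  have hV1 : ‖T * G‖ ≤ 1 := by
    have h1 : star (T * G) * (T * G) = cfc (fun x => g x * (x * g x)) Q := by
      rw [cfc_mul g (fun x => x * g x) Q (by fun_prop) (by fun_prop),
        cfc_mul (fun x => x) g Q (by fun_prop) (by fun_prop), cfc_id' ℝ Q, star_mul, hGsa, hQdef]
      simp only [mul_assoc]
      rfl
    have h2 : ‖star (T * G) * (T * G)‖ ≤ 1 := by
      rw [h1]
      refine norm_cfc_le zero_le_one fun x hx => ?_
      have hx0 := hsp x hx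
      have : g x * (x * g x) = (√x / (√x + s)) ^ 2 := by
        simp only [hg]
        rw [div_pow, Real.sq_sqrt hx0]
        field_simp
      rw [this, Real.norm_of_nonneg (by positivity)]
      apply pow_le_one₀ (by positivity)
      rw [div_le_one (by positivity)]
      linarith
    rw [CStarRing.norm_star_mul_self] at h2
    nlinarith [norm_nonneg (T * G)]
  refine ⟨T * G, mul_mem hT (hcfc g), cfc (fun x => √√x) Q, hcfc _, hV1, ?_, ?_, ?_⟩
  · rw [(cfc_predicate (fun x => √√x) Q : IsSelfAdjoint _).star_eq, hA,
      ← cfc_mul _ _ Q (by fun_prop) (by fun_prop)]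
    refine cfc_congr fun x _ => ?_
    exact Real.mul_self_sqrt (Real.sqrt_nonneg x)
  · have h1 : G * opAbs T + s • G = 1 := by
      rw [hA, hG, ← cfc_mul _ _ Q (by fun_prop) (by fun_prop), ← cfc_smul s g Q (by fun_prop),
        ← cfc_add Q _ _ (by fun_prop) (by fun_prop), ← cfc_const_one ℝ Q]
      refine cfc_congr fun x _ => ?_
      simp only [hg, smul_eq_mul]
      have := hpos x
      field_simp
    have h2 : T - T * G * opAbs T = s • (T * G) := by
      have : T = T * (G * opAbs T + s • G) := by rw [h1, mul_one]
      nth_rewrite 1 [this]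
      rw [mul_add, mul_smul_comm, ← mul_assoc]
      abel
    rw [h2, norm_smul, Real.norm_of_nonneg hs.le]
    nlinarith
  · have h1 : opAbs T - star (T * G) * T = cfc (fun x => √x - g x * x) Q := by
      rw [cfc_sub _ _ Q (by fun_prop) (by fun_prop), cfc_mul g (fun x => x) Q (by fun_prop)
        (by fun_prop), cfc_id' ℝ Q, star_mul, hGsa, hA, hQdef, mul_assoc]
    rw [h1]
    refine norm_cfc_le hs.le fun x hx => ?_
    have hx0 := hsp x hx
    have : √x - g x * x = s * (√x / (√x + s)) := by
      simp only [hg]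
      have := hpos x
      field_simp
      nlinarith [Real.sq_sqrt hx0]
    rw [this, Real.norm_of_nonneg (by positivity)]
    have : √x / (√x + s) ≤ 1 := by
      rw [div_le_one (by positivity)]
      linarith
    nlinarith

/-- The pairing `τ(B T)` is bounded by `‖B‖ τ(|T|)`. -/
lemma IsTracialOn.norm_mul_le_l1Norm {e : H} (he : ‖e‖ = 1)
    {S : StarSubalgebra ℂ (H →L[ℂ] H)} (hS : IsClosed (S : Set (H →L[ℂ] H)))
    (h : IsTracialOn e (S : Set (H →L[ℂ] H))) {B T : H →L[ℂ] H} (hB : B ∈ S) (hT : T ∈ S) :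
    ‖vecStateL e (B * T)‖ ≤ ‖B‖ * l1Norm e T := by
  refine le_of_forall_pos_le_add fun ε hε => ?_
  obtain ⟨V, hV, R, hR, hV1, hRR, hTV, -⟩ :=
    exists_approx_polar hS hT (s := ε / (‖B‖ + 1)) (by positivity)
  have h1 : vecStateL e (B * T) =
      vecStateL e (B * V * (star R * R)) + vecStateL e (B * (T - V * opAbs T)) := by
    rw [← map_add, hRR]
    congr 1
    noncomm_ring
  have h0 : 0 ≤ l1Norm e T := by
    have := vecStateL_star_mul_self_re e R
    rw [hRR] at this
    change 0 ≤ (vecStateL e (opAbs T)).re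
    rw [this]
    positivity
  have h2 : ‖vecStateL e (B * V * (star R * R))‖ ≤ ‖B‖ * l1Norm e T := by
    refine (h.norm_mul_star_mul_self_le (mul_mem hB hV) hR).trans ?_
    rw [hRR]
    change _ * l1Norm e T ≤ _
    gcongr
    exact (norm_mul_le _ _).trans (mul_le_of_le_one_right (norm_nonneg _) hV1)
  have h3 : ‖vecStateL e (B * (T - V * opAbs T))‖ ≤ ε := by
    refine (norm_vecStateL_le he _).trans ((norm_mul_le _ _).trans ?_)
    calc _ ≤ ‖B‖ * (ε / (‖B‖ + 1)) := by gcongr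
      _ = ε * (‖B‖ / (‖B‖ + 1)) := by ring
      _ ≤ ε * 1 := by
        gcongr
        rw [div_le_one (by positivity)]
        linarith
      _ = ε := mul_one _
  rw [h1]
  exact (norm_add_le _ _).trans (add_le_add h2 h3)

/-- The non-commutative `L¹` norm is at most any bound for the dual pairing with contractions. -/
lemma l1Norm_le_of_forall_contraction {e : H} (he : ‖e‖ = 1)
    {S : StarSubalgebra ℂ (H →L[ℂ] H)} (hS : IsClosed (S : Set (H →L[ℂ] H)))
    {T : H →L[ℂ] H} (hT : T ∈ S) {C : ℝ}
    (hC : ∀ X ∈ S, ‖X‖ ≤ 1 → ‖vecStateL e (X * T)‖ ≤ C) : l1Norm e T ≤ C := by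
  refine le_of_forall_pos_le_add fun ε hε => ?_
  obtain ⟨V, hV, -, -, hV1, -, -, hTV⟩ := exists_approx_polar hS hT hε
  have h1 : vecStateL e (opAbs T) =
      vecStateL e (star V * T) + vecStateL e (opAbs T - star V * T) := by
    rw [← map_add]
    congr 1
    abel
  calc l1Norm e T = (vecStateL e (opAbs T)).re := rfl
    _ ≤ ‖vecStateL e (opAbs T)‖ := Complex.re_le_norm _
    _ ≤ C + ε := by
      rw [h1]
      refine (norm_add_le _ _).trans (add_le_add (hC _ (star_mem hV) (by rwa [norm_star])) ?_)
      exact (norm_vecStateL_le he _).trans hTV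

end TraceState
section QuantumTorusModel

variable {H : Type*} [NormedAddCommGroup H] [InnerProductSpace ℂ H] [CompleteSpace H]

/-- A permutation of a Hilbert basis, twisted by phases, is implemented by a unitary. -/
lemma exists_unitary_map_hilbertBasis {ι : Type*} (b : HilbertBasis ι ℂ H) (σ : Equiv.Perm ι)
    (w : ι → Circle) :
    ∃ U : unitary (H →L[ℂ] H), ∀ i, (U : H →L[ℂ] H) (b i) = (w i : ℂ) • b (σ i) := by
  classical
  have hv : Orthonormal ℂ fun i => (w i : ℂ) • b (σ i) := by
    rw [orthonormal_iff_ite]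
    intro i j
    rw [inner_smul_left, inner_smul_right, orthonormal_iff_ite.mp b.orthonormal]
    by_cases h : i = j
    · subst h
      simp [← Complex.normSq_eq_conj_mul_self]
    · simp [h]
  have hsp : ⊤ ≤ (Submodule.span ℂ (Set.range fun i => (w i : ℂ) • b (σ i))).topologicalClosure := by
    rw [← b.dense_span]
    refine Submodule.topologicalClosure_mono (Submodule.span_le.2 ?_)
    rintro _ ⟨i, rfl⟩
    have h1 : (w (σ.symm i) : ℂ) • b (σ (σ.symm i)) ∈
        Submodule.span ℂ (Set.range fun i => (w i : ℂ) • b (σ i)) :=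
      Submodule.subset_span ⟨_, rfl⟩
    have h2 := Submodule.smul_mem _ ((w (σ.symm i) : ℂ)⁻¹) h1
    rwa [inv_smul_smul₀ (Circle.coe_ne_zero _), Equiv.apply_symm_apply] at h2
  refine ⟨Unitary.linearIsometryEquiv.symm (b.repr.trans (HilbertBasis.mk hv hsp).repr.symm),
    fun i => ?_⟩
  rw [Unitary.coe_symm_linearIsometryEquiv_apply]
  change (HilbertBasis.mk hv hsp).repr.symm (b.repr (b i)) = _
  rw [b.repr_self, HilbertBasis.repr_symm_single, HilbertBasis.coe_mk]

lemma unitary_zpow_apply_of_shift (u : unitary (H →L[ℂ] H)) (x : ℤ → H)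
    (hx : ∀ j, (u : H →L[ℂ] H) (x j) = x (j + 1)) (n : ℤ) :
    ∀ j, ((u ^ n : unitary (H →L[ℂ] H)) : H →L[ℂ] H) (x j) = x (j + n) := by
  have hinv : ∀ j, ((u⁻¹ : unitary (H →L[ℂ] H)) : H →L[ℂ] H) (x j) = x (j - 1) := by
    intro j
    have h := hx (j - 1)
    rw [sub_add_cancel] at h
    rw [← h]
    change (((u⁻¹ * u : unitary (H →L[ℂ] H)) : H →L[ℂ] H)) (x (j - 1)) = _
    rw [inv_mul_cancel]
    rfl
  induction n using Int.induction_on with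
  | zero => intro j; simp
  | succ n ih =>
    intro j
    rw [zpow_add_one]
    change ((u ^ (n : ℤ) : unitary (H →L[ℂ] H)) : H →L[ℂ] H) ((u : H →L[ℂ] H) (x j)) = _
    rw [hx, ih]
    congr 1
    ring
  | pred n ih =>
    intro j
    rw [zpow_sub_one]
    change ((u ^ (-n : ℤ) : unitary (H →L[ℂ] H)) : H →L[ℂ] H)
      (((u⁻¹ : unitary (H →L[ℂ] H)) : H →L[ℂ] H) (x j)) = _
    rw [hinv, ih]
    congr 1
    ring

/-- The regular representation of the rotation algebra on `ℓ²(ℤ²)`. -/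
lemma exists_quantumTorus (z : Circle) :
    ∃ S : HilbertSetup, ∃ U V : unitary (S.H →L[ℂ] S.H),
      (U : S.H →L[ℂ] S.H) * (V : S.H →L[ℂ] S.H) =
        (z : ℂ) • ((V : S.H →L[ℂ] S.H) * (U : S.H →L[ℂ] S.H)) ∧
      ∃ e : S.H, ‖e‖ = 1 ∧ ∀ k : ℤ × ℤ, k ≠ 0 → vecState e (qMono U V k) = 0 := by
  let b : HilbertBasis (ℤ × ℤ) ℂ (lp (fun _ : ℤ × ℤ => ℂ) 2) :=
    HilbertBasis.ofRepr (LinearIsometryEquiv.refl ℂ _)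
  obtain ⟨U, hU⟩ := exists_unitary_map_hilbertBasis b (Equiv.addRight ((1, 0) : ℤ × ℤ)) fun _ => 1
  obtain ⟨V, hV⟩ := exists_unitary_map_hilbertBasis b (Equiv.addRight ((0, 1) : ℤ × ℤ))
    fun k => z ^ (-k.1)
  refine ⟨⟨lp (fun _ : ℤ × ℤ => ℂ) 2⟩, U, V, ?_, b 0, b.orthonormal.1 0, fun k hk => ?_⟩
  · refine ContinuousLinearMap.ext_on (Submodule.dense_iff_topologicalClosure_eq_top.2 b.dense_span) ?_
    rintro _ ⟨k, rfl⟩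
    change U.1 (V.1 (b k)) = (z : ℂ) • V.1 (U.1 (b k))
    rw [hU, hV, map_smul, map_smul, hU, hV]
    simp only [Equiv.coe_addRight, Circle.coe_one, one_smul, smul_smul, Prod.fst_add]
    rw [add_right_comm]
    congr 1
    have hz : z ^ (-k.1) = z * z ^ (-(k.1 + 1)) := by
      rw [← zpow_one_add]
      congr 1
      ring
    rw [one_mul, hz]
    rfl
  · have h1 : (V ^ k.2).1 (b 0) = b (0, k.2) := by
      have := unitary_zpow_apply_of_shift V (fun j => b (0, j)) (fun j => by simp [hV]) k.2 0
      rw [zero_add] at this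
      exact this
    have h2 : (U ^ k.1).1 (b (0, k.2)) = b k := by
      have := unitary_zpow_apply_of_shift U (fun j => b (j, k.2)) (fun j => by simp [hU]) k.1 0
      rw [zero_add] at this
      exact this
    change inner ℂ (b 0) ((U ^ k.1).1 ((V ^ k.2).1 (b 0))) = 0
    rw [h1, h2]
    exact b.orthonormal.2 hk.symm

end QuantumTorusModel
section QuantumPolynomials

open Filter Topology

variable {H : Type*} [NormedAddCommGroup H] [InnerProductSpace ℂ H] [CompleteSpace H]

/-- Scalars of modulus one, as unitary operators. -/
def circleUnitary : Circle →* unitary (H →L[ℂ] H) where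
  toFun z := ⟨(z : ℂ) • 1, by
    rw [Unitary.mem_iff]
    constructor <;>
    · rw [star_smul, star_one, smul_mul_smul_comm, one_mul, RCLike.star_def]
      simp [← Complex.normSq_eq_conj_mul_self, Complex.mul_conj]⟩
  map_one' := by ext; simp
  map_mul' z w := by
    ext x
    change (((z * w : Circle) : ℂ) • x) = (z : ℂ) • (w : ℂ) • x
    rw [Circle.coe_mul, mul_smul]

lemma coe_circleUnitary_mul (z : Circle) (u : unitary (H →L[ℂ] H)) :
    ((circleUnitary z * u : unitary (H →L[ℂ] H)) : H →L[ℂ] H) = (z : ℂ) • (u : H →L[ℂ] H) := by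
  change ((z : ℂ) • (1 : H →L[ℂ] H)) * (u : H →L[ℂ] H) = _
  rw [smul_mul_assoc, one_mul]

lemma circleUnitary_commute (z : Circle) (u : unitary (H →L[ℂ] H)) :
    Commute (circleUnitary z) u := by
  apply Subtype.ext
  change ((z : ℂ) • (1 : H →L[ℂ] H)) * (u : H →L[ℂ] H) = (u : H →L[ℂ] H) * ((z : ℂ) • 1)
  simp

/-- Powers of two group elements whose commutator is central. -/
lemma zpow_mul_zpow_of_central {G : Type*} [Group G] {u v l : G} (hl : ∀ g, Commute l g)
    (h : u * v = l * (v * u)) (a b : ℤ) : u ^ a * v ^ b = l ^ (a * b) * (v ^ b * u ^ a) := by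
  have h1 : u * v * u⁻¹ = l * v := by rw [h]; group
  have h2 : u * v ^ b * u⁻¹ = l ^ b * v ^ b := by
    rw [← conj_zpow, h1, (hl v).mul_zpow]
  have h3 : (v ^ b)⁻¹ * u * v ^ b = l ^ b * u := by
    have h4 : u * v ^ b = l ^ b * v ^ b * u := by rw [← h2]; group
    rw [mul_assoc, h4, ((hl (v ^ b)).zpow_left b).eq]
    group
  have h5 : (v ^ b)⁻¹ * u ^ a * v ^ b = l ^ (a * b) * u ^ a := by
    have := conj_zpow (i := a) (a := (v ^ b)⁻¹) (b := u)
    rw [inv_inv] at this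
    rw [← this, h3, ((hl u).zpow_left b).mul_zpow, ← zpow_mul, mul_comm b a]
  have h6 : u ^ a * v ^ b = v ^ b * (l ^ (a * b) * u ^ a) := by rw [← h5]; group
  rw [h6, ← mul_assoc, ← ((hl (v ^ b)).zpow_left _).eq, mul_assoc]

variable {U V : unitary (H →L[ℂ] H)} {z : Circle}

lemma qMono_mul (hUV : (U : H →L[ℂ] H) * (V : H →L[ℂ] H) =
    (z : ℂ) • ((V : H →L[ℂ] H) * (U : H →L[ℂ] H))) (k l : ℤ × ℤ) :
    qMono U V k * qMono U V l = ((z ^ (-(l.1 * k.2)) : Circle) : ℂ) • qMono U V (k + l) := by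
  have h : U * V = circleUnitary z * (V * U) := by
    apply Subtype.ext
    rw [coe_circleUnitary_mul]
    exact hUV
  have h1 := zpow_mul_zpow_of_central (circleUnitary_commute z) h l.1 k.2
  have h2 : V ^ k.2 * U ^ l.1 = circleUnitary (z ^ (-(l.1 * k.2))) * (U ^ l.1 * V ^ k.2) := by
    rw [h1, map_zpow, ← mul_assoc, ← zpow_add, neg_add_cancel, zpow_zero, one_mul]
  have h3 : (U ^ k.1 * V ^ k.2) * (U ^ l.1 * V ^ l.2) =
      circleUnitary (z ^ (-(l.1 * k.2))) * (U ^ (k + l).1 * V ^ (k + l).2) := by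
    calc _ = U ^ k.1 * (V ^ k.2 * U ^ l.1) * V ^ l.2 := by group
      _ = (U ^ k.1 * circleUnitary (z ^ (-(l.1 * k.2)))) * (U ^ l.1 * V ^ k.2) * V ^ l.2 := by
        rw [h2]
        simp only [mul_assoc]
      _ = _ := by
        rw [← (circleUnitary_commute _ (U ^ k.1)).eq, Prod.fst_add, Prod.snd_add, zpow_add,
          zpow_add]
        simp only [mul_assoc]
  have h4 := congrArg (Subtype.val) h3
  rw [coe_circleUnitary_mul] at h4
  exact h4

lemma qMono_zero : qMono U V 0 = 1 := by
  simp [qMono]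

lemma star_qMono (hUV : (U : H →L[ℂ] H) * (V : H →L[ℂ] H) =
    (z : ℂ) • ((V : H →L[ℂ] H) * (U : H →L[ℂ] H))) (k : ℤ × ℤ) :
    star (qMono U V k) = ((z ^ (-(k.1 * k.2)) : Circle) : ℂ) • qMono U V (-k) := by
  have h1 : qMono U V k * (((z ^ (-(k.1 * k.2)) : Circle) : ℂ) • qMono U V (-k)) = 1 := by
    rw [mul_smul_comm, qMono_mul hUV, smul_smul, add_neg_cancel, qMono_zero, ← Circle.coe_mul,
      ← zpow_add]
    simp
  have h2 : star (qMono U V k) * qMono U V k = 1 :=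
    Unitary.coe_star_mul_self (U ^ k.1 * V ^ k.2)
  exact left_inv_eq_right_inv h2 h1

lemma qMono_comm (hUV : (U : H →L[ℂ] H) * (V : H →L[ℂ] H) =
    (z : ℂ) • ((V : H →L[ℂ] H) * (U : H →L[ℂ] H))) (k l : ℤ × ℤ) :
    qMono U V k * qMono U V l =
      ((z ^ (k.1 * l.2 - l.1 * k.2) : Circle) : ℂ) • (qMono U V l * qMono U V k) := by
  rw [qMono_mul hUV, qMono_mul hUV, smul_smul, ← Circle.coe_mul, ← zpow_add, add_comm k l]
  congr 3
  ring_nf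

lemma norm_qMono_le (k : ℤ × ℤ) : ‖qMono U V k‖ ≤ 1 :=
  ContinuousLinearMap.opNorm_le_bound _ zero_le_one fun x => by
    rw [one_mul]
    exact (Unitary.norm_map (U ^ k.1 * V ^ k.2) x).le

/-- The star algebra of non-commutative trigonometric polynomials. -/
def polyAlg (hUV : (U : H →L[ℂ] H) * (V : H →L[ℂ] H) =
    (z : ℂ) • ((V : H →L[ℂ] H) * (U : H →L[ℂ] H))) : StarSubalgebra ℂ (H →L[ℂ] H) where
  carrier := Submodule.span ℂ (Set.range (qMono U V))
  mul_mem' {A B} hA hB := by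
    refine Submodule.span_induction₂ (p := fun A B _ _ =>
      A * B ∈ Submodule.span ℂ (Set.range (qMono U V))) ?_ ?_ ?_ ?_ ?_ ?_ ?_ hA hB
    · rintro _ _ ⟨k, rfl⟩ ⟨l, rfl⟩
      rw [qMono_mul hUV]
      exact Submodule.smul_mem _ _ (Submodule.subset_span ⟨_, rfl⟩)
    · intro B _; simp
    · intro B _; simp
    · intro A A' B _ _ _ h h'; rw [add_mul]; exact add_mem h h'
    · intro A B B' _ _ _ h h'; rw [mul_add]; exact add_mem h h'
    · intro r A B _ _ h; rw [smul_mul_assoc]; exact Submodule.smul_mem _ _ h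
    · intro r A B _ _ h; rw [mul_smul_comm]; exact Submodule.smul_mem _ _ h
  add_mem' := add_mem
  algebraMap_mem' r := by
    rw [Algebra.algebraMap_eq_smul_one, ← qMono_zero (U := U) (V := V)]
    exact Submodule.smul_mem _ _ (Submodule.subset_span ⟨_, rfl⟩)
  star_mem' {A} hA := by
    refine Submodule.span_induction (p := fun A _ =>
      star A ∈ Submodule.span ℂ (Set.range (qMono U V))) ?_ ?_ ?_ ?_ hA
    · rintro _ ⟨k, rfl⟩
      rw [star_qMono hUV]
      exact Submodule.smul_mem _ _ (Submodule.subset_span ⟨_, rfl⟩)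
    · simp
    · intro A B _ _ h h'; rw [star_add]; exact add_mem h h'
    · intro r A _ h; rw [star_smul]; exact Submodule.smul_mem _ _ h

variable {hUV : (U : H →L[ℂ] H) * (V : H →L[ℂ] H) =
    (z : ℂ) • ((V : H →L[ℂ] H) * (U : H →L[ℂ] H))}

lemma qMono_mem_polyAlg (k : ℤ × ℤ) : qMono U V k ∈ polyAlg hUV :=
  Submodule.subset_span ⟨k, rfl⟩

lemma isTracialOn_polyAlg {e : H} (he : ∀ k : ℤ × ℤ, k ≠ 0 → vecState e (qMono U V k) = 0) :
    IsTracialOn e (polyAlg hUV : Set (H →L[ℂ] H)) := by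
  intro A hA B hB
  refine Submodule.span_induction₂ (p := fun A B _ _ =>
    vecStateL e (A * B) = vecStateL e (B * A)) ?_ ?_ ?_ ?_ ?_ ?_ ?_ hA hB
  · rintro _ _ ⟨k, rfl⟩ ⟨l, rfl⟩
    by_cases h : k + l = 0
    · obtain rfl : l = -k := (neg_eq_of_add_eq_zero_right h).symm
      rw [qMono_comm hUV]
      simp [mul_comm]
    · have h' : l + k ≠ 0 := by rwa [add_comm]
      rw [qMono_mul hUV, qMono_mul hUV, map_smul, map_smul, vecStateL_apply, vecStateL_apply,
        he _ h, he _ h', smul_zero, smul_zero]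
  · intro B _; simp
  · intro B _; simp
  · intro A A' B _ _ _ h h'; rw [add_mul, mul_add, map_add, map_add, h, h']
  · intro A B B' _ _ _ h h'; rw [add_mul, mul_add, map_add, map_add, h, h']
  · intro r A B _ _ h; rw [smul_mul_assoc, mul_smul_comm, map_smul, map_smul, h]
  · intro r A B _ _ h; rw [smul_mul_assoc, mul_smul_comm, map_smul, map_smul, h]

/-- The linear map `a ↦ δ_i δ_j (Σ_k a_k U^{k₁}V^{k₂})`. -/
def derivL (U V : unitary (H →L[ℂ] H)) (i j : ℕ) : ((ℤ × ℤ) →₀ ℂ) →ₗ[ℂ] (H →L[ℂ] H) :=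
  Finsupp.linearCombination ℂ fun k =>
    ((2 * (π : ℂ) * Complex.I * (kCoord i k : ℂ)) * (2 * (π : ℂ) * Complex.I * (kCoord j k : ℂ))) •
      qMono U V k

lemma derivL_apply (a : (ℤ × ℤ) →₀ ℂ) (i j : ℕ) : derivL U V i j a = derivPoly U V a i j := by
  rw [derivL, Finsupp.linearCombination_apply, Finsupp.sum, derivPoly]
  refine Finset.sum_congr rfl fun k _ => ?_
  rw [smul_smul, mul_comm (a k)]

lemma derivL_single (k : ℤ × ℤ) (c : ℂ) (i j : ℕ) : derivL U V i j (Finsupp.single k c) =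
    (c * ((2 * π * Complex.I) ^ 2 * (kCoord i k * kCoord j k : ℂ))) • qMono U V k := by
  rw [derivL, Finsupp.linearCombination_single, smul_smul]
  congr 1
  ring

lemma derivL_mem_polyAlg (a : (ℤ × ℤ) →₀ ℂ) (i j : ℕ) : derivL U V i j a ∈ polyAlg hUV := by
  rw [derivL_apply]
  exact sum_mem fun k _ => SMulMemClass.smul_mem _ (qMono_mem_polyAlg k)

/-- Large frequencies along which `z ^ m` tends to `1`. -/
lemma exists_filter_tendsto_pow_one (z : Circle) :
    ∃ ℓ : Filter ℕ, ℓ.NeBot ∧ ℓ ≤ atTop ∧ Tendsto (fun m : ℕ => z ^ m) ℓ (𝓝 1) := by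
  refine ⟨comap (z ^ · : ℕ → Circle) (𝓝 1) ⊓ atTop, ?_, inf_le_right,
    tendsto_comap.mono_left inf_le_left⟩
  have := mapClusterPt_one_atTop_pow z
  rw [MapClusterPt, ClusterPt, ← Filter.push_pull'] at this
  exact Filter.map_neBot_iff _ |>.1 this

/-- The high frequency unitary `U^{ε m} V^m`. -/
def highMono (U V : unitary (H →L[ℂ] H)) (ε : ℤ) (m : ℕ) : H →L[ℂ] H := qMono U V (ε * m, m)

/-- The real part of `U^{ε m} V^m`. -/
def highCos (U V : unitary (H →L[ℂ] H)) (ε : ℤ) (m : ℕ) : H →L[ℂ] H :=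
  (2⁻¹ : ℂ) • (highMono U V ε m + star (highMono U V ε m))

lemma star_mul_highMono (ε : ℤ) (m : ℕ) : star (highMono U V ε m) * highMono U V ε m = 1 :=
  Unitary.coe_star_mul_self (U ^ (ε * m) * V ^ (m : ℤ))

lemma highMono_mul_star (ε : ℤ) (m : ℕ) : highMono U V ε m * star (highMono U V ε m) = 1 :=
  Unitary.coe_mul_star_self (U ^ (ε * m) * V ^ (m : ℤ))

lemma highCos_mem_polyAlg (ε : ℤ) (m : ℕ) : highCos U V ε m ∈ polyAlg hUV :=
  SMulMemClass.smul_mem _ (add_mem (qMono_mem_polyAlg _) (star_mem (qMono_mem_polyAlg _)))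

lemma star_highCos (ε : ℤ) (m : ℕ) : star (highCos U V ε m) = highCos U V ε m := by
  simp [highCos, star_smul, add_comm]

lemma norm_highCos_le (ε : ℤ) (m : ℕ) : ‖highCos U V ε m‖ ≤ 1 := by
  have h1 : ‖highMono U V ε m‖ ≤ 1 := norm_qMono_le _
  have h2 : ‖highMono U V ε m + star (highMono U V ε m)‖ ≤ 1 + 1 :=
    (norm_add_le _ _).trans (add_le_add h1 ((norm_star _).trans_le h1))
  rw [highCos, norm_smul]
  norm_num
  linarith

/-- High frequencies asymptotically commute with every polynomial. -/
lemma tendsto_highMono_commutator {ℓ : Filter ℕ}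
    (hℓ : Tendsto (fun m : ℕ => z ^ m) ℓ (𝓝 1)) (ε : ℤ) {A : H →L[ℂ] H} (hA : A ∈ polyAlg hUV) :
    Tendsto (fun m => highMono U V ε m * A - A * highMono U V ε m) ℓ (𝓝 0) := by
  refine Submodule.span_induction (p := fun A _ =>
    Tendsto (fun m => highMono U V ε m * A - A * highMono U V ε m) ℓ (𝓝 0)) ?_ ?_ ?_ ?_ hA
  · rintro _ ⟨k, rfl⟩
    have h1 : ∀ m, highMono U V ε m * qMono U V k - qMono U V k * highMono U V ε m =
        ((((z ^ m) ^ (ε * k.2 - k.1) : Circle) : ℂ) - 1) • (qMono U V k * highMono U V ε m) := by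
      intro m
      rw [highMono, qMono_comm hUV, sub_smul, one_smul, ← zpow_natCast, ← zpow_mul]
      congr 4
      ring_nf
    have h2 : Tendsto (fun m => ((((z ^ m) ^ (ε * k.2 - k.1) : Circle) : ℂ) - 1)) ℓ (𝓝 0) := by
      have h3 : Continuous fun w : Circle => ((w ^ (ε * k.2 - k.1) : Circle) : ℂ) - 1 := by
        have hcoe : Continuous fun w : Circle => (w : ℂ) := continuous_subtype_val
        exact (hcoe.comp (continuous_zpow (ε * k.2 - k.1))).sub continuous_const
      have h4 := (h3.tendsto 1).comp hℓ
      simpa [Function.comp_def] using h4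
    refine squeeze_zero_norm (fun m => ?_) (tendsto_zero_iff_norm_tendsto_zero.1 h2)
    rw [h1, norm_smul]
    refine mul_le_of_le_one_right (norm_nonneg _) ((norm_mul_le _ _).trans ?_)
    exact mul_le_one₀ (norm_qMono_le _) (norm_nonneg _) (norm_qMono_le _)
  · simpa using tendsto_const_nhds
  · intro A B _ _ h h'
    simpa [mul_add, add_mul, add_sub_add_comm] using h.add h'
  · intro r A _ h
    simpa [smul_sub] using h.const_smul r

lemma tendsto_highCos_commutator {ℓ : Filter ℕ}
    (hℓ : Tendsto (fun m : ℕ => z ^ m) ℓ (𝓝 1)) (ε : ℤ) {A : H →L[ℂ] H} (hA : A ∈ polyAlg hUV) :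
    Tendsto (fun m => A * highCos U V ε m - highCos U V ε m * A) ℓ (𝓝 0) := by
  have h1 := tendsto_highMono_commutator hℓ ε hA
  have h2 := (tendsto_highMono_commutator hℓ ε (star_mem hA)).star
  have h3 := (h2.sub h1).const_smul (2⁻¹ : ℂ)
  simp only [star_zero, sub_zero, smul_zero] at h3
  refine h3.congr fun m => ?_
  simp only [highCos, star_sub, star_mul, star_star, mul_smul_comm, smul_mul_assoc, mul_add,
    add_mul, ← smul_sub]
  congr 1
  abel

lemma eventually_vecStateL_mul_qMono_mul {ℓ : Filter ℕ} (hℓ : ℓ ≤ atTop) {e : H}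
    (he : ∀ k : ℤ × ℤ, k ≠ 0 → vecState e (qMono U V k) = 0) (v : ℕ → ℤ × ℤ) {n : ℤ} (hn : n ≠ 0)
    (hv : ∀ m : ℕ, (v m).2 = n * m) {A B : H →L[ℂ] H}
    (hA : A ∈ polyAlg hUV) (hB : B ∈ polyAlg hUV) :
    ∀ᶠ m in ℓ, vecStateL e (A * qMono U V (v m) * B) = 0 := by
  refine Submodule.span_induction₂ (p := fun A B _ _ =>
    ∀ᶠ m in ℓ, vecStateL e (A * qMono U V (v m) * B) = 0) ?_ ?_ ?_ ?_ ?_ ?_ ?_ hA hB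
  · rintro _ _ ⟨k, rfl⟩ ⟨l, rfl⟩
    filter_upwards [hℓ (eventually_gt_atTop (k.2 + l.2).natAbs)] with m hm
    rw [qMono_mul hUV, smul_mul_assoc, qMono_mul hUV, map_smul, map_smul, vecStateL_apply, he,
      smul_zero, smul_zero]
    intro h
    have h2 := congrArg Prod.snd h
    simp only [Prod.snd_add, Prod.snd_zero, hv] at h2
    have h3 : k.2 + l.2 = -(n * m) := by linarith
    rw [h3, Int.natAbs_neg, Int.natAbs_mul, Int.natAbs_natCast] at hm
    have h4 : 1 ≤ n.natAbs := Int.natAbs_pos.2 hn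
    nlinarith
  · intro B _; simp
  · intro B _; simp
  · intro A A' B _ _ _ h h'
    filter_upwards [h, h'] with m hm hm'
    rw [add_mul, add_mul, map_add, hm, hm', add_zero]
  · intro A B B' _ _ _ h h'
    filter_upwards [h, h'] with m hm hm'
    rw [mul_add, map_add, hm, hm', add_zero]
  · intro r A B _ _ h
    filter_upwards [h] with m hm
    rw [smul_mul_assoc, smul_mul_assoc, map_smul, hm, smul_zero]
  · intro r A B _ _ h
    filter_upwards [h] with m hm
    rw [mul_smul_comm, map_smul, hm, smul_zero]

lemma eventually_vecStateL_mul_highCos_mul {ℓ : Filter ℕ} (hℓ : ℓ ≤ atTop) {e : H}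
    (he : ∀ k : ℤ × ℤ, k ≠ 0 → vecState e (qMono U V k) = 0) (ε : ℤ) {A B : H →L[ℂ] H}
    (hA : A ∈ polyAlg hUV) (hB : B ∈ polyAlg hUV) :
    ∀ᶠ m in ℓ, vecStateL e (A * highCos U V ε m * B) = 0 := by
  filter_upwards [eventually_vecStateL_mul_qMono_mul hℓ he (fun m => (ε * m, m)) one_ne_zero
      (fun m => (one_mul _).symm) hA hB,
    eventually_vecStateL_mul_qMono_mul hℓ he (fun m => -(ε * m, (m : ℤ))) (neg_ne_zero.2 one_ne_zero)
      (fun m => by simp) hA hB] with m h1 h2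
  rw [highCos, highMono, star_qMono hUV]
  simp only [mul_smul_comm, smul_mul_assoc, mul_add, add_mul, map_add, map_smul, h1, h2, smul_zero,
    add_zero]

lemma eventually_vecStateL_mul_highCos_sq_mul {ℓ : Filter ℕ} (hℓ : ℓ ≤ atTop) {e : H}
    (he : ∀ k : ℤ × ℤ, k ≠ 0 → vecState e (qMono U V k) = 0) (ε : ℤ) {A B : H →L[ℂ] H}
    (hA : A ∈ polyAlg hUV) (hB : B ∈ polyAlg hUV) :
    ∀ᶠ m in ℓ, vecStateL e (A * (highCos U V ε m * highCos U V ε m) * B) =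
      2⁻¹ * vecStateL e (A * B) := by
  filter_upwards [eventually_vecStateL_mul_qMono_mul hℓ he (fun m => (ε * m, (m : ℤ)) + (ε * m, (m : ℤ)))
      two_ne_zero (fun m => (two_mul _).symm) hA hB,
    eventually_vecStateL_mul_qMono_mul hℓ he (fun m => -(ε * m, (m : ℤ)) + -(ε * m, (m : ℤ)))
      (neg_ne_zero.2 two_ne_zero) (fun m => by simp; ring) hA hB] with m h1 h2
  have h3 : highCos U V ε m * highCos U V ε m = (2⁻¹ : ℂ) • 1 + (4⁻¹ : ℂ) •
      (highMono U V ε m * highMono U V ε m + star (highMono U V ε m) * star (highMono U V ε m)) := by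
    rw [highCos, smul_mul_smul_comm, mul_add, add_mul, add_mul, star_mul_highMono,
      highMono_mul_star]
    module
  rw [h3, highMono, star_qMono hUV, smul_mul_smul_comm, qMono_mul hUV, qMono_mul hUV]
  simp only [mul_smul_comm, smul_mul_assoc, mul_add, add_mul, map_add, map_smul, h1, h2, add_zero,
    mul_zero, mul_one, smul_eq_mul]

end QuantumPolynomials
section RieszProduct

open Filter Topology

variable {H : Type*} [NormedAddCommGroup H] [InnerProductSpace ℂ H] [CompleteSpace H]
  {U V : unitary (H →L[ℂ] H)} {z : Circle}

lemma tendsto_quadratic_div_sq (a b c d : ℂ) :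
    Tendsto (fun m : ℕ => ((m : ℂ) * a + b) * (m * c + d) * ((m : ℂ) ^ 2)⁻¹) atTop
      (𝓝 (a * c)) := by
  have h0 : Tendsto (fun m : ℕ => ((m : ℂ))⁻¹) atTop (𝓝 0) :=
    tendsto_inv_atTop_nhds_zero_nat (𝕜 := ℂ)
  have h1 : Tendsto (fun m : ℕ => (a + b * (m : ℂ)⁻¹) * (c + d * (m : ℂ)⁻¹)) atTop
      (𝓝 ((a + b * 0) * (c + d * 0))) :=
    ((h0.const_mul b).const_add a).mul ((h0.const_mul d).const_add c)
  simp only [mul_zero, add_zero] at h1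
  refine h1.congr' ?_
  filter_upwards [eventually_ne_atTop 0] with m hm
  have : (m : ℂ) ≠ 0 := Nat.cast_ne_zero.2 hm
  field_simp

lemma tendsto_smul_zero_of_norm_le_one {ι E : Type*} [NormedAddCommGroup E] [NormedSpace ℂ E]
    {ℓ : Filter ι} {r : ι → ℂ} {X : ι → E} (hr : Tendsto r ℓ (𝓝 0)) (hX : ∀ i, ‖X i‖ ≤ 1) :
    Tendsto (fun i => r i • X i) ℓ (𝓝 0) := by
  refine squeeze_zero_norm (fun i => ?_) (tendsto_zero_iff_norm_tendsto_zero.1 hr)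
  rw [norm_smul]
  exact mul_le_of_le_one_right (norm_nonneg _) (hX i)

/-- Modulating a polynomial `P` by the cosine of a high frequency vector `m (ε, 1)` gives an
asymptotic eigenvector of all second order derivations. -/
lemma exists_tendsto_derivL_highCos
    {hUV : (U : H →L[ℂ] H) * (V : H →L[ℂ] H) = (z : ℂ) • ((V : H →L[ℂ] H) * (U : H →L[ℂ] H))}
    {ℓ : Filter ℕ} (hℓ : ℓ ≤ atTop) (ε : ℤ) {P : H →L[ℂ] H} (hP : P ∈ polyAlg hUV) :
    ∃ g : ℕ → ((ℤ × ℤ) →₀ ℂ), ∀ i j : ℕ, Tendsto (fun m => derivL U V i j (g m) -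
      ((kCoord i (ε, 1) : ℂ) * (kCoord j (ε, 1) : ℂ)) • (highCos U V ε m * P)) ℓ (𝓝 0) := by
  refine Submodule.span_induction (p := fun P _ => ∃ g : ℕ → ((ℤ × ℤ) →₀ ℂ), ∀ i j : ℕ,
    Tendsto (fun m => derivL U V i j (g m) -
      ((kCoord i (ε, 1) : ℂ) * (kCoord j (ε, 1) : ℂ)) • (highCos U V ε m * P)) ℓ (𝓝 0))
    ?_ ?_ ?_ ?_ hP
  · rintro _ ⟨k, rfl⟩
    have hx : ∀ m : ℕ, ∃ x : ℂ, highMono U V ε m * qMono U V k =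
        x • qMono U V ((ε * m, (m : ℤ)) + k) := fun m => ⟨_, qMono_mul hUV _ _⟩
    have hy : ∀ m : ℕ, ∃ y : ℂ, star (highMono U V ε m) * qMono U V k =
        y • qMono U V (-(ε * m, (m : ℤ)) + k) := fun m => by
      rw [highMono, star_qMono hUV, smul_mul_assoc, qMono_mul hUV, smul_smul]
      exact ⟨_, rfl⟩
    choose x hx using hx
    choose y hy using hy
    refine ⟨fun m => Finsupp.single ((ε * m, (m : ℤ)) + k)
        (2⁻¹ * x m * ((2 * π * Complex.I) ^ 2 * (m : ℂ) ^ 2)⁻¹) +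
      Finsupp.single (-(ε * m, (m : ℤ)) + k)
        (2⁻¹ * y m * ((2 * π * Complex.I) ^ 2 * (m : ℂ) ^ 2)⁻¹), fun i j => ?_⟩
    set s : ℕ → ℂ := fun i => (kCoord i (ε, 1) : ℂ) with hs
    set q : ℕ → ℂ := fun i => (kCoord i k : ℂ) with hq
    have hplus : ∀ (m : ℕ) i, (kCoord i ((ε * m, (m : ℤ)) + k) : ℂ) = m * s i + q i := by
      intro m i
      simp only [hs, hq, kCoord]
      split_ifs <;> simp [mul_comm]
    have hminus : ∀ (m : ℕ) i, (kCoord i (-(ε * m, (m : ℤ)) + k) : ℂ) = m * (-s i) + q i := by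
      intro m i
      simp only [hs, hq, kCoord]
      split_ifs <;> simp [mul_comm]
    have hpi : (2 * π * Complex.I : ℂ) ^ 2 ≠ 0 := by
      simp [Real.pi_ne_zero]
    have key : ∀ m : ℕ,
        (2⁻¹ * (((m : ℂ) * s i + q i) * (m * s j + q j) * ((m : ℂ) ^ 2)⁻¹ - s i * s j)) •
            (highMono U V ε m * qMono U V k) +
          (2⁻¹ * (((m : ℂ) * (-s i) + q i) * (m * (-s j) + q j) * ((m : ℂ) ^ 2)⁻¹ -
            (-s i) * (-s j))) • (star (highMono U V ε m) * qMono U V k) =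
        derivL U V i j (Finsupp.single ((ε * m, (m : ℤ)) + k)
            (2⁻¹ * x m * ((2 * π * Complex.I) ^ 2 * (m : ℂ) ^ 2)⁻¹) +
          Finsupp.single (-(ε * m, (m : ℤ)) + k)
            (2⁻¹ * y m * ((2 * π * Complex.I) ^ 2 * (m : ℂ) ^ 2)⁻¹)) -
          (s i * s j) • (highCos U V ε m * qMono U V k) := by
      intro m
      rw [map_add, derivL_single, derivL_single, hplus, hplus, hminus, hminus, highCos,
        smul_mul_assoc, add_mul (highMono U V ε m), hx, hy, mul_inv]
      generalize ((m : ℂ) ^ 2)⁻¹ = r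
      have h1 : ∀ t u : ℂ, 2⁻¹ * t * (((2 * π * Complex.I) ^ 2)⁻¹ * r) *
          ((2 * π * Complex.I) ^ 2 * u) = 2⁻¹ * t * r * u := fun t u => by
        field_simp
      rw [h1, h1]
      module
    have hW : ∀ m, ‖highMono U V ε m‖ ≤ 1 := fun m => norm_qMono_le _
    have lim : ∀ a b c d : ℂ, Tendsto (fun m : ℕ =>
        2⁻¹ * (((m : ℂ) * a + b) * (m * c + d) * ((m : ℂ) ^ 2)⁻¹ - a * c)) ℓ (𝓝 0) := by
      intro a b c d
      have h := (((tendsto_quadratic_div_sq a b c d).mono_left hℓ).sub_const (a * c)).const_mul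
        (2⁻¹ : ℂ)
      simpa using h
    have h1 := tendsto_smul_zero_of_norm_le_one (lim (s i) (q i) (s j) (q j))
      (X := fun m => highMono U V ε m * qMono U V k) fun m => (norm_mul_le _ _).trans
        (mul_le_one₀ (hW m) (norm_nonneg _) (norm_qMono_le _))
    have h2 := tendsto_smul_zero_of_norm_le_one (lim (-s i) (q i) (-s j) (q j))
      (X := fun m => star (highMono U V ε m) * qMono U V k) fun m => (norm_mul_le _ _).trans
        (mul_le_one₀ ((norm_star _).trans_le (hW m)) (norm_nonneg _) (norm_qMono_le _))
    have h3 := h1.add h2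
    rw [add_zero] at h3
    exact h3.congr key
  · exact ⟨0, fun i j => by simpa using tendsto_const_nhds⟩
  · rintro A B _ _ ⟨g, hg⟩ ⟨h, hh⟩
    refine ⟨g + h, fun i j => ?_⟩
    have := (hg i j).add (hh i j)
    rw [add_zero] at this
    refine this.congr fun m => ?_
    rw [Pi.add_apply, map_add, mul_add, smul_add]
    abel
  · rintro r A _ ⟨g, hg⟩
    refine ⟨r • g, fun i j => ?_⟩
    have := (hg i j).const_smul r
    rw [smul_zero] at this
    refine this.congr fun m => ?_
    rw [Pi.smul_apply, map_smul, mul_smul_comm, smul_sub, smul_comm r]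

/-- Approximate data of a Riesz product `Y* Y` with `n` factors: a polynomial with coefficients `a`
whose pure second derivatives are close to `Y* Y - 1`, and a test operator `B` whose pairings with
`Y* Y` and with the mixed derivative are close to `α` and `β`. -/
def RieszApprox
    (hUV : (U : H →L[ℂ] H) * (V : H →L[ℂ] H) = (z : ℂ) • ((V : H →L[ℂ] H) * (U : H →L[ℂ] H)))
    (e : H) (δ : ℝ) (n : ℕ) (α β : ℂ) : Prop :=
  ∀ η > (0 : ℝ), ∃ Y ∈ polyAlg hUV, ∃ B ∈ polyAlg hUV, ∃ a : (ℤ × ℤ) →₀ ℂ,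
    ‖B‖ ^ 2 ≤ (1 + δ ^ 2) ^ n ∧ vecStateL e (star Y * Y) = 1 ∧
    ‖derivL U V 1 1 a - (star Y * Y - 1)‖ < η ∧ ‖derivL U V 2 2 a - (star Y * Y - 1)‖ < η ∧
    ‖vecStateL e (B * (star Y * Y)) - α‖ < η ∧ ‖vecStateL e (B * derivL U V 1 2 a) - β‖ < η

variable {hUV : (U : H →L[ℂ] H) * (V : H →L[ℂ] H) =
    (z : ℂ) • ((V : H →L[ℂ] H) * (U : H →L[ℂ] H))} {e : H}

lemma rieszApprox_zero (hnorm : ‖e‖ = 1) (δ : ℝ) : RieszApprox hUV e δ 0 1 0 := by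
  intro η hη
  refine ⟨1, one_mem _, 1, one_mem _, 0, ?_, ?_, ?_, ?_, ?_, ?_⟩
  · have : ‖(1 : H →L[ℂ] H)‖ ≤ 1 := ContinuousLinearMap.norm_id_le
    rw [pow_zero]
    exact pow_le_one₀ (norm_nonneg _) this
  all_goals simp [vecStateL_one hnorm, hη]

lemma norm_one_add_I_smul_selfAdjoint_sq_le {c : H →L[ℂ] H} (hc : star c = c) (hc1 : ‖c‖ ≤ 1)
    (t : ℝ) : ‖1 + (Complex.I * t) • c‖ ^ 2 ≤ 1 + t ^ 2 := by
  have h1 : star (1 + (Complex.I * t) • c) * (1 + (Complex.I * t) • c) =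
      1 + ((t : ℂ) ^ 2) • (c * c) := by
    have hI : (starRingEnd ℂ) (Complex.I * t) = -(Complex.I * t) := by simp
    rw [star_add, star_one, star_smul, hc, RCLike.star_def, hI, mul_add, add_mul, add_mul,
      smul_mul_smul_comm]
    simp only [mul_one, one_mul]
    have : -(Complex.I * t) * (Complex.I * t) = (t : ℂ) ^ 2 := by
      linear_combination (-(t : ℂ) ^ 2) * Complex.I_sq
    rw [this]
    module
  rw [sq, ← CStarRing.norm_star_mul_self, h1]
  refine (norm_add_le _ _).trans (add_le_add ContinuousLinearMap.norm_id_le ?_)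
  rw [norm_smul, norm_pow, Complex.norm_real, Real.norm_eq_abs, sq_abs]
  exact mul_le_of_le_one_right (sq_nonneg t)
    ((norm_mul_le _ _).trans (mul_le_one₀ hc1 (norm_nonneg _) hc1))

/-- One more Riesz factor, of frequency `m (ε, 1)` with `m` large. -/
lemma RieszApprox.step (hnorm : ‖e‖ = 1)
    (he : ∀ k : ℤ × ℤ, k ≠ 0 → vecState e (qMono U V k) = 0) {δ : ℝ} (hδ : |δ| ≤ 1)
    {n : ℕ} {α β : ℂ} {ε : ℤ} (hε : ε * ε = 1) (h : RieszApprox hUV e δ n α β) :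
    RieszApprox hUV e δ (n + 1) (α * (1 + Complex.I * δ * ε / 2)) (β + Complex.I * δ / 2 * α) := by
  intro η hη
  obtain ⟨Y, hY, B, hB, a, hBn, hY1, h11, h22, hα, hβ⟩ := h (η / 4) (by positivity)
  obtain ⟨ℓ, _, hℓ, hz⟩ := exists_filter_tendsto_pow_one z
  set P := star Y * Y with hPdef
  set T := derivL U V 1 2 a with hTdef
  have hP : P ∈ polyAlg hUV := mul_mem (star_mem hY) hY
  have hT : T ∈ polyAlg hUV := derivL_mem_polyAlg a 1 2
  obtain ⟨g, hg⟩ := exists_tendsto_derivL_highCos hℓ ε hP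
  set η' := η / (8 * (‖B‖ + 1)) with hη'
  have hη'0 : 0 < η' := by positivity
  have hη'1 : η' ≤ η / 8 := by
    rw [hη']
    apply div_le_div_of_nonneg_left hη.le (by norm_num)
    linarith [norm_nonneg B]
  have hη'2 : 2 * ‖B‖ * η' ≤ η / 4 := by
    have : 2 * ‖B‖ * η' = η / 4 * (‖B‖ / (‖B‖ + 1)) := by
      rw [hη']
      field_simp
      ring
    rw [this]
    refine mul_le_of_le_one_right (by positivity) ?_
    rw [div_le_one (by positivity)]
    linarith
  have hE : Tendsto (fun m => (star Y * highCos U V ε m - highCos U V ε m * star Y) * Y) ℓ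
      (𝓝 0) := by
    simpa using (tendsto_highCos_commutator hz ε (star_mem hY)).mul_const Y
  have small : ∀ {X : ℕ → H →L[ℂ] H}, Tendsto X ℓ (𝓝 0) → ∀ᶠ m in ℓ, ‖X m‖ < η' := fun hX => by
    simpa using hX.norm.eventually (gt_mem_nhds (by simpa using hη'0))
  obtain ⟨m, s11, s22, s12, sE, v1, v2, v3, v4⟩ :=
    ((small (hg 1 1)).and <| (small (hg 2 2)).and <| (small (hg 1 2)).and <| (small hE).and <|
      (eventually_vecStateL_mul_highCos_mul hℓ he ε (star_mem hY) hY).and <|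
      (eventually_vecStateL_mul_highCos_mul hℓ he ε hB hP).and <|
      (eventually_vecStateL_mul_highCos_mul hℓ he ε hB hT).and <|
      eventually_vecStateL_mul_highCos_sq_mul hℓ he ε hB hP).exists
  have hεC : (ε : ℂ) * ε = 1 := by exact_mod_cast hε
  have hεR : (ε : ℝ) ^ 2 = 1 := by rw [sq]; exact_mod_cast hε
  have hεa : |(ε : ℝ)| = 1 := by
    rw [← sq_eq_sq₀ (abs_nonneg _) zero_le_one, sq_abs, hεR, one_pow]
  simp only [kCoord, if_true, OfNat.ofNat_ne_one, if_false, hεC, Int.cast_one, mul_one,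
    one_smul] at s11 s22 s12
  set c := highCos U V ε m with hc
  set W := highMono U V ε m with hW
  set E := (star Y * c - c * star Y) * Y with hEdef
  set B' := B * (1 + (Complex.I * ((δ * ε : ℝ) : ℂ)) • c) with hB'
  set Y' := (((√2)⁻¹ : ℝ) : ℂ) • ((1 + W) * Y) with hY'
  have hcn : ‖c‖ ≤ 1 := norm_highCos_le ε m
  have hcs : star c = c := star_highCos ε m
  have hWS : W ∈ polyAlg hUV := qMono_mem_polyAlg _
  have hcS : c ∈ polyAlg hUV := highCos_mem_polyAlg ε m
  have hP'1 : star Y' * Y' = P + star Y * c * Y := by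
    have h2 : (((√2)⁻¹ : ℝ) : ℂ) * (((√2)⁻¹ : ℝ) : ℂ) = 2⁻¹ := by
      rw [← Complex.ofReal_mul, ← mul_inv, Real.mul_self_sqrt (by norm_num)]
      norm_num
    have h3 : star (1 + W) * (1 + W) = (2 : ℂ) • (1 + c) := by
      rw [star_add, star_one, mul_add, add_mul, add_mul, star_mul_highMono, hc, highCos, ← hW]
      simp only [one_mul, mul_one]
      module
    rw [hY', star_smul, smul_mul_smul_comm, RCLike.star_def, Complex.conj_ofReal, h2, star_mul,
      mul_assoc, ← mul_assoc (star (1 + W)), h3, smul_mul_assoc, mul_smul_comm, smul_smul]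
    norm_num [add_mul, mul_add, mul_assoc, hPdef]
  have hP'2 : star Y' * Y' = P + c * P + E := by
    rw [hP'1, hEdef, hPdef]
    noncomm_ring
  have hB'n : ‖B'‖ ^ 2 ≤ (1 + δ ^ 2) ^ (n + 1) := by
    have h1 := norm_one_add_I_smul_selfAdjoint_sq_le hcs hcn (δ * ε)
    rw [mul_pow, hεR, mul_one] at h1
    calc ‖B'‖ ^ 2 ≤ (‖B‖ * ‖1 + (Complex.I * ((δ * ε : ℝ) : ℂ)) • c‖) ^ 2 := by
          gcongr
          exact norm_mul_le _ _
      _ = ‖B‖ ^ 2 * ‖1 + (Complex.I * ((δ * ε : ℝ) : ℂ)) • c‖ ^ 2 := mul_pow _ _ _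
      _ ≤ (1 + δ ^ 2) ^ n * (1 + δ ^ 2) := by gcongr
      _ = _ := (pow_succ _ _).symm
  have hB'2 : ‖B'‖ ≤ 2 * ‖B‖ := by
    have h1 : ‖1 + (Complex.I * ((δ * ε : ℝ) : ℂ)) • c‖ ≤ 2 := by
      refine (norm_add_le _ _).trans ?_
      rw [norm_smul, norm_mul, Complex.norm_I, one_mul, Complex.norm_real, Real.norm_eq_abs,
        abs_mul, hεa, mul_one]
      have h2 : ‖(1 : H →L[ℂ] H)‖ ≤ 1 := ContinuousLinearMap.norm_id_le
      have h3 := mul_le_one₀ hδ (norm_nonneg c) hcn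
      linarith
    refine (norm_mul_le _ _).trans ?_
    rw [mul_comm]
    gcongr
  have hBs : ∀ {X : H →L[ℂ] H}, ‖X‖ < η' → ‖vecStateL e (B' * X)‖ ≤ η / 4 := fun {X} hX => by
    refine (norm_vecStateL_le hnorm _).trans ((norm_mul_le _ _).trans (le_trans ?_ hη'2))
    gcongr
  have hpure : ∀ {D G : H →L[ℂ] H}, ‖D - (P - 1)‖ < η / 4 → ‖G - c * P‖ < η' →
      ‖D + G - (star Y' * Y' - 1)‖ < η := fun {D G} hD hG => by
    have h1 : D + G - (star Y' * Y' - 1) = D - (P - 1) + (G - c * P) - E := by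
      rw [hP'2]
      abel
    rw [h1]
    have := norm_sub_le (D - (P - 1) + (G - c * P)) E
    have := norm_add_le (D - (P - 1)) (G - c * P)
    linarith
  have expand : ∀ X : H →L[ℂ] H, vecStateL e (B' * X) =
      vecStateL e (B * X) + Complex.I * δ * ε * vecStateL e (B * c * X) := fun X => by
    rw [hB', mul_add, mul_one, add_mul, mul_smul_comm, smul_mul_assoc, map_add, map_smul]
    push_cast
    rw [smul_eq_mul, ← mul_assoc Complex.I]
  have eP : vecStateL e (B' * P) = vecStateL e (B * P) := by
    rw [expand, v2, mul_zero, add_zero]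
  have ecP : vecStateL e (B' * (c * P)) = Complex.I * δ * ε / 2 * vecStateL e (B * P) := by
    rw [expand, ← mul_assoc, v2, mul_assoc B c (c * P), ← mul_assoc c c P, ← mul_assoc B, v4]
    ring
  have eT : vecStateL e (B' * T) = vecStateL e (B * T) := by
    rw [expand, v3, mul_zero, add_zero]
  have hεn : ‖(ε : ℂ)‖ = 1 := by
    rw [← Complex.ofReal_intCast, Complex.norm_real, Real.norm_eq_abs, hεa]
  have hδn : ‖(δ : ℂ)‖ ≤ 1 := by rwa [Complex.norm_real, Real.norm_eq_abs]
  refine ⟨Y', SMulMemClass.smul_mem _ (mul_mem (add_mem (one_mem _) hWS) hY), B',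
    mul_mem hB (add_mem (one_mem _) (SMulMemClass.smul_mem _ hcS)), a + g m, hB'n, ?_, ?_, ?_, ?_,
    ?_⟩
  · rw [hP'1, map_add, v1, hY1, add_zero]
  · rw [map_add]
    exact hpure h11 s11
  · rw [map_add]
    exact hpure h22 s22
  · have h1 : vecStateL e (B' * (star Y' * Y')) - α * (1 + Complex.I * δ * ε / 2) =
        (vecStateL e (B * P) - α) + Complex.I * δ * ε / 2 * (vecStateL e (B * P) - α) +
          vecStateL e (B' * E) := by
      rw [hP'2, mul_add, mul_add, map_add, map_add, eP, ecP]
      ring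
    have h2 : ‖Complex.I * δ * ε / 2 * (vecStateL e (B * P) - α)‖ ≤
        ‖vecStateL e (B * P) - α‖ := by
      rw [norm_mul]
      refine mul_le_of_le_one_left (norm_nonneg _) ?_
      rw [norm_div, norm_mul, norm_mul, Complex.norm_I, hεn]
      norm_num
      linarith
    rw [h1]
    refine (norm_add₃_le).trans_lt ?_
    linarith [hBs sE]
  · set G := derivL U V 1 2 (g m) - (ε : ℂ) • (c * P) with hG
    have h1 : vecStateL e (B' * derivL U V 1 2 (a + g m)) - (β + Complex.I * δ / 2 * α) =
        (vecStateL e (B * T) - β) + Complex.I * δ / 2 * (vecStateL e (B * P) - α) +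
          vecStateL e (B' * G) := by
      have h2 : derivL U V 1 2 (a + g m) = T + (ε : ℂ) • (c * P) + G := by
        rw [map_add, hG]
        abel
      rw [h2, mul_add, mul_add, map_add, map_add, mul_smul_comm, map_smul, eT, ecP, smul_eq_mul]
      linear_combination (Complex.I * δ / 2 * vecStateL e (B * P)) * hεC
    have h2 : ‖Complex.I * δ / 2 * (vecStateL e (B * P) - α)‖ ≤
        ‖vecStateL e (B * P) - α‖ := by
      rw [norm_mul]
      refine mul_le_of_le_one_left (norm_nonneg _) ?_
      rw [norm_div, norm_mul, Complex.norm_I]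
      norm_num
      linarith
    rw [h1]
    refine (norm_add₃_le).trans_lt ?_
    linarith [hBs s12]

end RieszProduct
section NonInequality

variable {H : Type*} [NormedAddCommGroup H] [InnerProductSpace ℂ H] [CompleteSpace H]
  {U V : unitary (H →L[ℂ] H)} {z : Circle}
  {hUV : (U : H →L[ℂ] H) * (V : H →L[ℂ] H) = (z : ℂ) • ((V : H →L[ℂ] H) * (U : H →L[ℂ] H))} {e : H}

/-- Along an even number of steps with alternating signs the mixed pairing grows linearly. -/
lemma exists_rieszApprox (hnorm : ‖e‖ = 1)
    (he : ∀ k : ℤ × ℤ, k ≠ 0 → vecState e (qMono U V k) = 0) {δ : ℝ} (hδ0 : 0 ≤ δ)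
    (hδ : |δ| ≤ 1) (n : ℕ) :
    ∃ (t : ℝ) (β : ℂ), 1 ≤ t ∧ n * δ ≤ β.im ∧ RieszApprox hUV e δ (2 * n) t β := by
  induction n with
  | zero => exact ⟨1, 0, le_rfl, by simp, by simpa using rieszApprox_zero hnorm δ⟩
  | succ n ih =>
    obtain ⟨t, β, ht, hβ, h⟩ := ih
    have h' := (h.step hnorm he hδ (ε := 1) (by norm_num)).step hnorm he hδ (ε := -1) (by norm_num)
    have hα : (t : ℂ) * (1 + Complex.I * δ * (1 : ℤ) / 2) *
        (1 + Complex.I * δ * (-1 : ℤ) / 2) = ((t * (1 + δ ^ 2 / 4) : ℝ) : ℂ) := by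
      push_cast
      linear_combination (-(t : ℂ) * δ ^ 2 / 4) * Complex.I_sq
    rw [hα] at h'
    refine ⟨_, _, ?_, ?_, h'⟩
    · nlinarith [sq_nonneg δ]
    · have h2 : (β + Complex.I * δ / 2 * t + Complex.I * δ / 2 *
          (t * (1 + Complex.I * δ * (1 : ℤ) / 2))).im = β.im + δ * t := by
        have h3 : β + Complex.I * δ / 2 * t + Complex.I * δ / 2 *
            (t * (1 + Complex.I * δ * (1 : ℤ) / 2)) =
            β + ((-(δ ^ 2 * t / 4) : ℝ) : ℂ) + ((δ * t : ℝ) : ℂ) * Complex.I := by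
          push_cast
          linear_combination ((δ : ℂ) ^ 2 * t / 4) * Complex.I_sq
        rw [h3, Complex.add_im, Complex.add_im, Complex.ofReal_im, Complex.im_ofReal_mul,
          Complex.I_im, add_zero, mul_one]
      rw [h2]
      push_cast
      nlinarith

lemma exists_l1Norm_derivPoly_le_and_le
    (hUV : (U : H →L[ℂ] H) * (V : H →L[ℂ] H) = (z : ℂ) • ((V : H →L[ℂ] H) * (U : H →L[ℂ] H)))
    (hnorm : ‖e‖ = 1) (he : ∀ k : ℤ × ℤ, k ≠ 0 → vecState e (qMono U V k) = 0) (K : ℝ) :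
    ∃ a : (ℤ × ℤ) →₀ ℂ, l1Norm e (derivPoly U V a 1 1) + l1Norm e (derivPoly U V a 2 2) ≤ 1 ∧
      K ≤ l1Norm e (derivPoly U V a 1 2) := by
  obtain ⟨n, hn⟩ := exists_nat_ge (18 * (|K| + 1) + 1)
  have hn1 : (1 : ℝ) ≤ n := by linarith [abs_nonneg K]
  have hn0 : (0 : ℝ) < n := by linarith
  set δ : ℝ := (n : ℝ)⁻¹ with hδ
  have hδ0 : 0 ≤ δ := by positivity
  have hδ1 : |δ| ≤ 1 := by
    rw [abs_of_nonneg hδ0]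
    exact inv_le_one_of_one_le₀ hn1
  obtain ⟨t, β, -, hβ, h⟩ := exists_rieszApprox (hUV := hUV) hnorm he hδ0 hδ1 (n ^ 2)
  have hβ' : (n : ℝ) ≤ β.im := by
    refine le_trans (le_of_eq ?_) hβ
    rw [hδ]
    push_cast
    field_simp
  obtain ⟨Y, hY, B, hB, a, hBn, hY1, h11, h22, -, h12⟩ := h 1 one_pos
  have hBle : ‖B‖ ≤ 3 := by
    have h1 : (1 + δ ^ 2) ^ (2 * n ^ 2) ≤ Real.exp 2 := by
      calc (1 + δ ^ 2) ^ (2 * n ^ 2) ≤ Real.exp (δ ^ 2) ^ (2 * n ^ 2) := by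
            gcongr
            linarith [Real.add_one_le_exp (δ ^ 2)]
        _ = Real.exp 2 := by
            rw [← Real.exp_nat_mul, hδ]
            push_cast
            congr 1
            field_simp
    have h2 : Real.exp 2 ≤ 3 ^ 2 := by
      rw [show (2 : ℝ) = (2 : ℕ) * 1 by norm_num, Real.exp_nat_mul]
      have := Real.exp_one_lt_d9
      gcongr
      linarith
    exact (sq_le_sq₀ (norm_nonneg B) (by norm_num)).1 ((hBn.trans h1).trans h2)
  set S : Set (H →L[ℂ] H) := ((polyAlg hUV).topologicalClosure : Set (H →L[ℂ] H)) with hS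
  have htr : IsTracialOn e S := by
    rw [hS, StarSubalgebra.topologicalClosure_coe]
    exact isTracialOn_closure (isTracialOn_polyAlg he)
  have hcl : IsClosed S := StarSubalgebra.isClosed_topologicalClosure _
  have hle : ∀ {X : H →L[ℂ] H}, X ∈ polyAlg hUV → X ∈ (polyAlg hUV).topologicalClosure :=
    fun hX => StarSubalgebra.le_topologicalClosure _ hX
  obtain ⟨κ, hκn⟩ : ∃ κ : ℂ, ‖κ‖ = 6⁻¹ := ⟨6⁻¹, by simp⟩
  have upper : ∀ i : ℕ, ‖derivL U V i i a - (star Y * Y - 1)‖ < 1 →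
      l1Norm e (derivPoly U V (κ • a) i i) ≤ 2⁻¹ := fun i hi => by
    rw [← derivL_apply, map_smul]
    refine l1Norm_le_of_forall_contraction hnorm hcl
      (hle (SMulMemClass.smul_mem _ (derivL_mem_polyAlg a i i))) fun X hX hX1 => ?_
    set R := derivL U V i i a - (star Y * Y - 1) with hR
    have hD : derivL U V i i a = star Y * Y - 1 + R := by
      rw [hR]
      abel
    rw [mul_smul_comm, map_smul, norm_smul, hκn, hD, mul_add, mul_sub, mul_one, map_add, map_sub]
    have b1 := htr.norm_mul_star_mul_self_le hX (hle hY)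
    rw [hY1, Complex.one_re, mul_one] at b1
    have b2 := norm_vecStateL_le hnorm X
    have b3 : ‖vecStateL e (X * R)‖ ≤ 1 := (norm_vecStateL_le hnorm _).trans
      ((norm_mul_le _ _).trans (mul_le_one₀ hX1 (norm_nonneg _) hi.le))
    have b4 := norm_add_le (vecStateL e (X * (star Y * Y)) - vecStateL e X) (vecStateL e (X * R))
    have b5 := norm_sub_le (vecStateL e (X * (star Y * Y))) (vecStateL e X)
    linarith
  refine ⟨κ • a, ?_, ?_⟩
  · exact (add_le_add (upper 1 h11) (upper 2 h22)).trans_eq (by norm_num)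
  · have l1 := htr.norm_mul_le_l1Norm hnorm hcl (hle hB)
      (hle (SMulMemClass.smul_mem κ (derivL_mem_polyAlg a 1 2)))
    rw [mul_smul_comm, map_smul, norm_smul, hκn, ← map_smul, derivL_apply _ 1 2, derivL_apply _ 1 2] at l1
    have l2 : (n : ℝ) - 1 ≤ ‖vecStateL e (B * derivL U V 1 2 a)‖ := by
      have := norm_sub_norm_le β (β - vecStateL e (B * derivL U V 1 2 a))
      rw [sub_sub_cancel, norm_sub_rev β] at this
      have := (le_abs_self _).trans (Complex.abs_im_le_norm β)
      linarith
    have l3 : (|K| + 1) * 3 ≤ ‖B‖ * l1Norm e (derivPoly U V (κ • a) 1 2) := by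
      rw [derivL_apply] at l2
      exact le_trans (by linarith) l1
    by_contra! hlt
    have hK : l1Norm e (derivPoly U V (κ • a) 1 2) < |K| := hlt.trans_le (le_abs_self K)
    have hK0 : 0 ≤ |K| := abs_nonneg K
    rcases le_or_gt (l1Norm e (derivPoly U V (κ • a) 1 2)) 0 with hl | hl
    · have := mul_nonpos_of_nonneg_of_nonpos (norm_nonneg B) hl
      nlinarith
    · nlinarith

end NonInequality
/-- (Ornstein non-inequality on the quantum torus) There is `c > 0` such that
for every irrational `θ ∈ [0,1]` and every `N ≥ 2` there exist a complex Hilbert space, unitaries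
`U, V` with `U V = e^{2πiθ} V U`, a unit trace vector `e₀`, and a non-commutative trigonometric
polynomial `f = Σ_k a_k U^{k₁}V^{k₂}` such that `τ(|δ₁²f|) + τ(|δ₂²f|) ≤ 1` while
`τ(|δ₁δ₂f|) ≥ c (log N)^{1/2}`. -/
theorem stmt_15 :
    ∃ c > (0 : ℝ), ∀ θ : ℝ, θ ∈ Set.Icc (0 : ℝ) 1 → Irrational θ → ∀ N : ℕ, 2 ≤ N →
      ∃ S : HilbertSetup, ∃ U V : unitary (S.H →L[ℂ] S.H),
        ((U : S.H →L[ℂ] S.H) * (V : S.H →L[ℂ] S.H)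
          = Complex.exp (2 * (Real.pi : ℂ) * Complex.I * (θ : ℂ)) •
              ((V : S.H →L[ℂ] S.H) * (U : S.H →L[ℂ] S.H))) ∧
        ∃ e₀ : S.H, ‖e₀‖ = 1 ∧
          (∀ k : ℤ × ℤ, k ≠ 0 → vecState e₀ (qMono U V k) = 0) ∧
          ∃ a : (ℤ × ℤ) →₀ ℂ,
            l1Norm e₀ (derivPoly U V a 1 1) + l1Norm e₀ (derivPoly U V a 2 2) ≤ 1 ∧
            c * Real.sqrt (Real.log (N : ℝ)) ≤ l1Norm e₀ (derivPoly U V a 1 2) := by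
  refine ⟨1, one_pos, fun θ _ _ N _ => ?_⟩
  obtain ⟨S, U, V, hUV, e, hnorm, he⟩ := exists_quantumTorus (Circle.exp (2 * π * θ))
  obtain ⟨a, ha, ha'⟩ := exists_l1Norm_derivPoly_le_and_le hUV hnorm he √(Real.log N)
  refine ⟨S, U, V, ?_, e, hnorm, he, a, ha, by rwa [one_mul]⟩
  rw [hUV, Circle.coe_exp]
  push_cast
  congr 2
  ring

end
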